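/- Let U be a real-valued random variable with probability density f_U, where f_U(t) = (1/√(2π))·(t+1)^{−1/2}·e^{−(t+1)/2} for t > −1 and f_U(t) = 0 for t ≤ −1. Let V be a real-valued random variable independent of U having a probability density f_V such that f_V(t) = 0 for all t < −M for some M > 0, and f_V(t) ≤ C·(1+|t|)^k·e^{−c′t/2} for all t ∈ ℝ, where C > 0, k ≥ 0 is an integer, and c′ ≥ 1. Let w ∈ (0, 1) satisfy w·c′/√(1−w²) ≤ 1. Then w·U + √(1−w²)·V has a probability density h, and there exist a constant C′ > 0 and x₀ ∈ ℝ such that h(x) ≤ C′·(1+x)^{k+1}·e^{−c′x/(2√(1−w²))} for almost every x ≥ x₀. -/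

import Mathlib

open MeasureTheory ProbabilityTheory

/-- The density of the centered chi-square distribution `χ²₁ − 1`. -/
noncomputable def centeredChiSqPDF (t : ℝ) : ℝ :=
  if -1 < t then
    (Real.sqrt (2 * Real.pi))⁻¹ * (t + 1) ^ (-(1 : ℝ) / 2) * Real.exp (-(t + 1) / 2)
  else 0

lemma aux_sum_density {Ω : Type*} [MeasurableSpace Ω] {P : Measure Ω} [IsProbabilityMeasure P]
    {U V : Ω → ℝ} (hUm : Measurable U) (hVm : Measurable V) (hindep : IndepFun U V P)
    {f g : ℝ → ENNReal} (hf : Measurable f) (hg : Measurable g)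
    (hU : Measure.map U P = volume.withDensity f) (hV : Measure.map V P = volume.withDensity g)
    {w s : ℝ} (hs : 0 < s) :
    Measure.map (fun ω => w * U ω + s * V ω) P =
      volume.withDensity
        (fun x => ∫⁻ u, f u * (ENNReal.ofReal |s⁻¹| * g ((x - w * u) / s))) := by
  have key : ∀ (A : Set ℝ), MeasurableSet A → ∀ u : ℝ,
      ∫⁻ v, g v * A.indicator 1 (w * u + s * v) =
        ∫⁻ x, ENNReal.ofReal |s⁻¹| * g ((x - w * u) / s) * A.indicator 1 x := by
    intro A hA u
    have hind : Measurable (A.indicator (1 : ℝ → ENNReal)) := measurable_one.indicator hA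
    have h1 : ∫⁻ v, g v * A.indicator 1 (w * u + s * v) =
        ∫⁻ y, g (y / s) * A.indicator 1 (w * u + y) ∂(Measure.map (fun x => s * x) volume) := by
      rw [lintegral_map (by fun_prop) (by fun_prop)]
      refine lintegral_congr fun v => ?_
      rw [mul_div_cancel_left₀ _ hs.ne']
    rw [h1, Real.map_volume_mul_left hs.ne', lintegral_smul_measure,
      ← lintegral_sub_right_eq_self _ (w * u), smul_eq_mul, ← lintegral_const_mul _ (by fun_prop)]
    refine lintegral_congr fun x => ?_
    rw [add_sub_cancel, mul_assoc]
  have hprod := hindep.map_prod_eq_prod_map_map hUm.aemeasurable hVm.aemeasurable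
  ext A hA
  have hind : Measurable (A.indicator (1 : ℝ → ENNReal)) := measurable_one.indicator hA
  have hfin1 : IsProbabilityMeasure (Measure.map U P) :=
    Measure.isProbabilityMeasure_map hUm.aemeasurable
  have hfin2 : IsProbabilityMeasure (Measure.map V P) :=
    Measure.isProbabilityMeasure_map hVm.aemeasurable
  have e1 : Measure.map (fun ω => w * U ω + s * V ω) P A =
      ∫⁻ p, A.indicator 1 (w * p.1 + s * p.2) ∂(Measure.map (fun ω => (U ω, V ω)) P) := by
    rw [lintegral_map (by fun_prop) (by fun_prop), ← lintegral_indicator_one hA,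
      lintegral_map hind (by fun_prop)]
  rw [e1, hprod, lintegral_prod _ (by fun_prop)]
  have e2 : ∀ u, ∫⁻ v, A.indicator 1 (w * u + s * v) ∂(Measure.map V P) =
      ∫⁻ x, ENNReal.ofReal |s⁻¹| * g ((x - w * u) / s) * A.indicator 1 x := by
    intro u
    rw [← key A hA u, hV, lintegral_withDensity_eq_lintegral_mul _ hg (by fun_prop)]
    rfl
  simp only [e2]
  rw [hU, lintegral_withDensity_eq_lintegral_mul _ hf
    (Measurable.lintegral_prod_right' (f := fun p : ℝ × ℝ =>
      ENNReal.ofReal |s⁻¹| * g ((p.2 - w * p.1) / s) * A.indicator 1 p.2) (by fun_prop))]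
  simp only [Pi.mul_apply]
  have e3 : ∀ u, f u * ∫⁻ x, ENNReal.ofReal |s⁻¹| * g ((x - w * u) / s) * A.indicator 1 x =
      ∫⁻ x, f u * (ENNReal.ofReal |s⁻¹| * g ((x - w * u) / s)) * A.indicator 1 x := by
    intro u
    rw [← lintegral_const_mul _ (by fun_prop)]
    simp only [mul_assoc]
  simp only [e3]
  rw [lintegral_lintegral_swap (by
    apply Measurable.aemeasurable
    unfold Function.uncurry
    fun_prop), withDensity_apply _ hA, ← lintegral_indicator hA]
  refine lintegral_congr fun x => ?_
  rw [lintegral_mul_const _ (by fun_prop)]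
  by_cases hx : x ∈ A <;> simp [hx]

lemma aux_pdf_nonneg (u : ℝ) : 0 ≤ centeredChiSqPDF u := by
  unfold centeredChiSqPDF
  split_ifs with h
  · have : 0 < u + 1 := by linarith
    positivity
  · exact le_rfl

lemma aux_pdf_measurable : Measurable centeredChiSqPDF := by
  unfold centeredChiSqPDF
  exact Measurable.ite measurableSet_Ioi (by fun_prop) (by fun_prop)

lemma aux_pdf_le {u : ℝ} (hu : 0 < u) : centeredChiSqPDF u ≤ Real.exp (-u / 2) := by
  unfold centeredChiSqPDF
  rw [if_pos (by linarith)]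
  have h1 : (Real.sqrt (2 * Real.pi))⁻¹ ≤ 1 := by
    apply inv_le_one_of_one_le₀
    rw [Real.one_le_sqrt]
    linarith [Real.pi_gt_three]
  have h2 : (u + 1) ^ (-(1 : ℝ) / 2) ≤ 1 :=
    Real.rpow_le_one_of_one_le_of_nonpos (by linarith) (by norm_num)
  have h3 : Real.exp (-(u + 1) / 2) ≤ Real.exp (-u / 2) := Real.exp_le_exp.2 (by linarith)
  have h4 : 0 ≤ (u + 1) ^ (-(1 : ℝ) / 2) := Real.rpow_nonneg (by linarith) _
  calc _ ≤ 1 * 1 * Real.exp (-u / 2) := by gcongr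
    _ = _ := by ring

lemma aux_pdf_exp {u a L : ℝ} (ha0 : 0 ≤ a) (ha : a ≤ 1) (hL : u ≤ L) :
    centeredChiSqPDF u * Real.exp (a * u / 2) ≤
      centeredChiSqPDF u + (Set.Ioc 0 L).indicator 1 u := by
  have h0 := aux_pdf_nonneg u
  by_cases hu : 0 < u
  · rw [Set.indicator_of_mem (show u ∈ Set.Ioc 0 L from ⟨hu, hL⟩)]
    have h1 := aux_pdf_le hu
    have : centeredChiSqPDF u * Real.exp (a * u / 2) ≤ 1 := by
      calc _ ≤ Real.exp (-u / 2) * Real.exp (a * u / 2) := by gcongr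
        _ = Real.exp (-((1 - a) * u) / 2) := by rw [← Real.exp_add]; ring_nf
        _ ≤ 1 := by
          rw [Real.exp_le_one_iff]
          have : 0 ≤ (1 - a) * u := mul_nonneg (by linarith) hu.le
          linarith
    simp only [Pi.one_apply]
    linarith
  · rw [Set.indicator_of_notMem (fun h => hu h.1)]
    have : Real.exp (a * u / 2) ≤ 1 := by
      rw [Real.exp_le_one_iff]
      have : a * u ≤ 0 := mul_nonpos_of_nonneg_of_nonpos ha0 (not_lt.1 hu)
      linarith
    nlinarith

lemma aux_pointwise {fV : ℝ → ℝ} {M : ℝ} (hM : 0 < M) (hVsupp : ∀ t, t < -M → fV t = 0)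
    {C : ℝ} (hC : 0 < C) {k : ℕ} {c' : ℝ} (hc' : 1 ≤ c')
    (hVbound : ∀ t, fV t ≤ C * (1 + |t|) ^ k * Real.exp (-c' * t / 2))
    {w s : ℝ} (hw : 0 < w) (hs : 0 < s) (hwc : w * c' / s ≤ 1) {x : ℝ} (hx : 0 ≤ x) (u : ℝ) :
    centeredChiSqPDF u * (s⁻¹ * fV ((x - w * u) / s)) ≤
      s⁻¹ * C * ((1 + M + w / s + 1 / s) * (1 + x)) ^ k * Real.exp (-c' * x / (2 * s)) *
        (centeredChiSqPDF u + (Set.Ioc 0 ((x + s * M) / w)).indicator 1 u) := by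
  have h0 := aux_pdf_nonneg u
  have hi : (0 : ℝ) ≤ (Set.Ioc 0 ((x + s * M) / w)).indicator 1 u :=
    Set.indicator_nonneg (fun _ _ => zero_le_one) _
  have hB : 0 ≤ s⁻¹ * C * ((1 + M + w / s + 1 / s) * (1 + x)) ^ k *
      Real.exp (-c' * x / (2 * s)) := by positivity
  by_cases hu : -1 < u
  swap
  · have : centeredChiSqPDF u = 0 := by simp [centeredChiSqPDF, hu]
    rw [this, zero_mul]
    rw [this] at h0
    positivity
  by_cases ht : (x - w * u) / s < -M
  · rw [hVsupp _ ht, mul_zero, mul_zero]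
    positivity
  have ht' : -M ≤ (x - w * u) / s := not_lt.1 ht
  have hL : u ≤ (x + s * M) / w := by
    rw [le_div_iff₀ hw]
    rw [le_div_iff₀ hs] at ht'
    linarith
  have habs : 1 + |(x - w * u) / s| ≤ (1 + M + w / s + 1 / s) * (1 + x) := by
    have h1 : (x - w * u) / s ≤ x / s + w / s := by
      rw [← add_div]
      gcongr
      nlinarith
    have h2 : 0 ≤ x / s := by positivity
    have h3 : 0 ≤ w / s := by positivity
    have h4 : |(x - w * u) / s| ≤ M + x / s + w / s := by
      rw [abs_le]; constructor <;> linarith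
    have h5 : (1 + M + w / s + 1 / s) * (1 + x) =
      1 + M + w / s + x / s + (1 / s + x + M * x + w / s * x) := by ring
    have h6 : 0 ≤ 1 / s + x + M * x + w / s * x := by positivity
    linarith
  have hexp : Real.exp (-c' * ((x - w * u) / s) / 2) =
      Real.exp (-c' * x / (2 * s)) * Real.exp (w * c' / s * u / 2) := by
    rw [← Real.exp_add]
    congr 1
    field_simp
    ring
  have hmain := aux_pdf_exp (a := w * c' / s) (by positivity) hwc hL
  calc centeredChiSqPDF u * (s⁻¹ * fV ((x - w * u) / s))
      ≤ centeredChiSqPDF u * (s⁻¹ * (C * (1 + |(x - w * u) / s|) ^ k *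
          Real.exp (-c' * ((x - w * u) / s) / 2))) := by
        gcongr
        exact hVbound _
    _ ≤ centeredChiSqPDF u * (s⁻¹ * (C * ((1 + M + w / s + 1 / s) * (1 + x)) ^ k *
          Real.exp (-c' * ((x - w * u) / s) / 2))) := by
        gcongr
    _ = s⁻¹ * C * ((1 + M + w / s + 1 / s) * (1 + x)) ^ k * Real.exp (-c' * x / (2 * s)) *
        (centeredChiSqPDF u * Real.exp (w * c' / s * u / 2)) := by
        rw [hexp]; ring
    _ ≤ _ := by gcongr

/-- paper's Lemma 2, the inductive step. If `U` is a centered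
chi-square random variable independent of `V`, whose density is supported on
`[−M, ∞)` and bounded by `C·(1+|t|)^k·e^{−c′t/2}` with `c′ ≥ 1`, and
`w ∈ (0,1)` satisfies `w·c′/√(1−w²) ≤ 1`, then `w·U + √(1−w²)·V` has a density
eventually bounded by `C′·(1+x)^{k+1}·e^{−c′x/(2√(1−w²))}`. -/
theorem inductive_step_weighted_sum_density_decay
    {Ω : Type*} [MeasureSpace Ω] [IsProbabilityMeasure (ℙ : Measure Ω)]
    (U V : Ω → ℝ) (hUm : Measurable U) (hVm : Measurable V)
    (hindep : IndepFun U V ℙ)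
    (hU : Measure.map U ℙ =
      volume.withDensity fun t => ENNReal.ofReal (centeredChiSqPDF t))
    (fV : ℝ → ℝ)
    (hV : Measure.map V ℙ =
      volume.withDensity fun t => ENNReal.ofReal (fV t))
    (M : ℝ) (hM : 0 < M) (hVsupp : ∀ t, t < -M → fV t = 0)
    (C : ℝ) (hC : 0 < C) (k : ℕ) (c' : ℝ) (hc' : 1 ≤ c')
    (hVbound : ∀ t, fV t ≤ C * (1 + |t|) ^ k * Real.exp (-c' * t / 2))
    (w : ℝ) (hw : w ∈ Set.Ioo (0 : ℝ) 1)
    (hwc : w * c' / Real.sqrt (1 - w ^ 2) ≤ 1) :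
    ∃ h : ℝ → ℝ,
      Measure.map (fun ω => w * U ω + Real.sqrt (1 - w ^ 2) * V ω) ℙ =
        volume.withDensity (fun x => ENNReal.ofReal (h x)) ∧
      ∃ C' > (0 : ℝ), ∃ x₀ : ℝ, ∀ᵐ x ∂(volume : Measure ℝ), x₀ ≤ x →
        h x ≤ C' * (1 + x) ^ (k + 1) *
          Real.exp (-c' * x / (2 * Real.sqrt (1 - w ^ 2))) := by
  obtain ⟨hw0, hw1⟩ := hw
  have hs : 0 < Real.sqrt (1 - w ^ 2) := Real.sqrt_pos.2 (by nlinarith)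
  set s := Real.sqrt (1 - w ^ 2) with hsdef
  clear_value s
  obtain ⟨g, hgm, hgle, hgeq⟩ :=
    exists_measurable_le_withDensity_eq volume (fun t => ENNReal.ofReal (fV t))
  have hpm := aux_pdf_measurable
  have hfm : Measurable (fun t => ENNReal.ofReal (centeredChiSqPDF t)) :=
    aux_pdf_measurable.ennreal_ofReal
  have hW := aux_sum_density hUm hVm hindep hfm hgm hU (hV.trans hgeq.symm) (w := w) hs
  set H : ℝ → ENNReal := fun x => ∫⁻ u, ENNReal.ofReal (centeredChiSqPDF u) *
    (ENNReal.ofReal |s⁻¹| * g ((x - w * u) / s)) with hH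
  have hHm : Measurable H := Measurable.lintegral_prod_right' (f := fun p : ℝ × ℝ =>
    ENNReal.ofReal (centeredChiSqPDF p.2) *
      (ENNReal.ofReal |s⁻¹| * g ((p.1 - w * p.2) / s))) (by fun_prop)
  have hP : IsProbabilityMeasure (Measure.map (fun ω => w * U ω + s * V ω) ℙ) :=
    Measure.isProbabilityMeasure_map (by fun_prop)
  have hHint : ∫⁻ x, H x = 1 := by
    have := hP.measure_univ
    rwa [hW, withDensity_apply _ MeasurableSet.univ, Measure.restrict_univ] at this
  have hfint : ∫⁻ u, ENNReal.ofReal (centeredChiSqPDF u) = 1 := by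
    have h1 : IsProbabilityMeasure (Measure.map U ℙ) :=
      Measure.isProbabilityMeasure_map hUm.aemeasurable
    have := h1.measure_univ
    rwa [hU, withDensity_apply _ MeasurableSet.univ, Measure.restrict_univ] at this
  refine ⟨fun x => (H x).toReal, ?_, s⁻¹ * C * (1 + M + w / s + 1 / s) ^ k *
    (1 + 1 / w + s * M / w), by positivity, 0, Filter.Eventually.of_forall fun x hx => ?_⟩
  · rw [hW]
    refine withDensity_congr_ae ?_
    filter_upwards [ae_lt_top hHm (by rw [hHint]; exact ENNReal.one_ne_top)] with x hx
    rw [ENNReal.ofReal_toReal hx.ne]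
  · refine ENNReal.toReal_le_of_le_ofReal (by positivity) ?_
    set B := s⁻¹ * C * ((1 + M + w / s + 1 / s) * (1 + x)) ^ k *
      Real.exp (-c' * x / (2 * s)) with hBdef
    have hB : 0 ≤ B := by positivity
    have hL : 0 ≤ (x + s * M) / w := by positivity
    have hpt : ∀ u, ENNReal.ofReal (centeredChiSqPDF u) *
        (ENNReal.ofReal |s⁻¹| * g ((x - w * u) / s)) ≤
        ENNReal.ofReal B * (ENNReal.ofReal (centeredChiSqPDF u) +
          (Set.Ioc 0 ((x + s * M) / w)).indicator 1 u) := by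
      intro u
      have hi : (0 : ℝ) ≤ (Set.Ioc 0 ((x + s * M) / w)).indicator 1 u :=
        Set.indicator_nonneg (fun _ _ => zero_le_one) _
      have hie : (Set.Ioc 0 ((x + s * M) / w)).indicator (1 : ℝ → ENNReal) u =
          ENNReal.ofReal ((Set.Ioc 0 ((x + s * M) / w)).indicator 1 u) := by
        by_cases h : u ∈ Set.Ioc 0 ((x + s * M) / w) <;> simp [h]
      rw [hie, ← ENNReal.ofReal_add (aux_pdf_nonneg u) hi, ← ENNReal.ofReal_mul hB]
      calc _ ≤ ENNReal.ofReal (centeredChiSqPDF u) *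
          (ENNReal.ofReal |s⁻¹| * ENNReal.ofReal (fV ((x - w * u) / s))) := by
            gcongr
            exact hgle _
        _ = ENNReal.ofReal (centeredChiSqPDF u * (s⁻¹ * fV ((x - w * u) / s))) := by
            rw [ENNReal.ofReal_mul (aux_pdf_nonneg u), ENNReal.ofReal_mul (by positivity),
              abs_of_pos (inv_pos.2 hs)]
        _ ≤ _ := ENNReal.ofReal_le_ofReal
            (aux_pointwise hM hVsupp hC hc' hVbound hw0 hs hwc hx u)
    calc H x ≤ ∫⁻ u, ENNReal.ofReal B * (ENNReal.ofReal (centeredChiSqPDF u) +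
          (Set.Ioc 0 ((x + s * M) / w)).indicator 1 u) := lintegral_mono hpt
      _ = ENNReal.ofReal (B * (1 + (x + s * M) / w)) := by
          have hind : Measurable ((Set.Ioc 0 ((x + s * M) / w)).indicator (1 : ℝ → ENNReal)) :=
            measurable_one.indicator measurableSet_Ioc
          rw [lintegral_const_mul _ (by fun_prop), lintegral_add_left hfm, hfint,
            lintegral_indicator_one measurableSet_Ioc, Real.volume_Ioc, sub_zero,
            ENNReal.ofReal_mul hB, ENNReal.ofReal_add zero_le_one hL, ENNReal.ofReal_one]
      _ ≤ _ := by
          apply ENNReal.ofReal_le_ofReal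
          have h1 : 1 + (x + s * M) / w ≤ (1 + 1 / w + s * M / w) * (1 + x) := by
            have h5 : (1 + 1 / w + s * M / w) * (1 + x) =
              1 + (x + s * M) / w + (1 / w + x + s * M / w * x) := by ring
            have h6 : 0 ≤ 1 / w + x + s * M / w * x := by positivity
            linarith
          calc _ ≤ B * ((1 + 1 / w + s * M / w) * (1 + x)) := by gcongr
            _ = _ := by rw [hBdef, mul_pow]; ring
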